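/- Let A be a finite set of m ≥ 2 alternatives and D a nonempty family of subsets of L(A) each of cardinality at most K. Let 0 ≤ ε < ε′ < 1 and 0 < δ < 1/2, and set ℓ = ⌈(64/(ε′−ε)²)·(K·m·ln m + ln(1/δ))⌉. Define f : L(A)^ℓ → {0,1} by f(S) = 1 iff the preference-distance of the ℓ-tuple S from D is at most (ε+ε′)ℓ/2. Then for every fixed profile P of n preferences over A: if the preference-distance of P from D is at most εn, then the probability over sampling that f applied to an ℓ-sample from P equals 1 is at least 1−δ; and if the preference-distance of P from D is at least ε′n, then the probability that f applied to an ℓ-sample from P equals 0 is at least 1−δ. -/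

import Mathlib

/-- A strict linear order on `A`, encoded as a Boolean relation. -/
def IsLinOrd {A : Type*} (r : A → A → Bool) : Prop :=
  (∀ a, ¬ r a a) ∧ (∀ a b c, r a b → r b c → r a c) ∧ (∀ a b, a ≠ b → r a b ∨ r b a)

instance IsLinOrd.decPred {A : Type*} [Fintype A] [DecidableEq A] :
    DecidablePred (@IsLinOrd A) := fun r => by
  unfold IsLinOrd; infer_instance

/-- A preference: a strict linear order on the set `A` of alternatives. -/
abbrev Pref (A : Type*) := {r : A → A → Bool // IsLinOrd r}

/-- Restriction of a preference to a subset `X` of the alternatives. -/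
def Pref.restrict {A : Type*} (r : Pref A) (X : Finset A) : Pref {a // a ∈ X} :=
  ⟨fun u v => r.1 u.1 v.1, by
    obtain ⟨h1, h2, h3⟩ := r.2
    exact ⟨fun u => h1 u.1, fun u v w => h2 u.1 v.1 w.1,
      fun u v huv => h3 u.1 v.1 (fun h => huv (Subtype.ext h))⟩⟩

/-- `r` is single-peaked with respect to the societal axis `ax`. -/
def SinglePeakedWrt {A : Type*} (ax r : Pref A) : Prop :=
  ∀ t : A, (∀ z, z ≠ t → r.1 t z) → ∀ u v : A,
    (((ax.1 t u ∧ ax.1 u v) ∨ (ax.1 v u ∧ ax.1 u t)) ∨ (u = t ∧ v ≠ t)) → r.1 u v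

/-- A profile is single-peaked if there is a single axis w.r.t. which every preference
of the profile is single-peaked. -/
def IsSinglePeaked {A ι : Type*} (P : ι → Pref A) : Prop :=
  ∃ ax : Pref A, ∀ i, SinglePeakedWrt ax (P i)

/-- A profile (in its given order) is single-crossing: for each ordered pair of
alternatives, the relative order changes at most once along the sequence. -/
def SingleCrossingInOrder {A : Type*} {n : ℕ} (P : Fin n → Pref A) : Prop :=
  ∀ a b : A, ∀ i j k : Fin n, i ≤ j → j ≤ k → (P i).1 a b → (P k).1 a b → (P j).1 a b

/-- A profile is single-crossing if some reordering of its preferences is single-crossing. -/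
def IsSingleCrossing {A ι : Type*} [Fintype ι] (P : ι → Pref A) : Prop :=
  ∃ e : Fin (Fintype.card ι) ≃ ι, SingleCrossingInOrder (fun i => P (e i))

/-- Probability of an event under the uniform distribution on a finite sample space. -/
noncomputable def pr {Ω : Type*} [Fintype Ω] (E : Ω → Prop) : ℝ :=
  haveI := Classical.decPred E
  ((Finset.univ.filter E).card : ℝ) / (Fintype.card Ω : ℝ)

/-- Number of occurrences of the order `q` in the tuple `S` of preferences. -/
noncomputable def countPref {A : Type*} {ℓ : ℕ} (S : Fin ℓ → Pref A) (q : Pref A) : ℕ :=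
  haveI : DecidableEq (Pref A) := Classical.decEq _
  (Finset.univ.filter (fun j => S j = q)).card

/-- Preference-distance of a profile from a domain `D`: `n` minus the maximum size of
an index set whose subprofile lies in a single member of `D`. -/
noncomputable def prefDist {A : Type*} {n : ℕ} (D : Finset (Finset (Pref A)))
    (P : Fin n → Pref A) : ℕ :=
  haveI := Classical.decPred (fun J : Finset (Fin n) => ∃ S ∈ D, ∀ i ∈ J, P i ∈ S)
  n - ((Finset.univ : Finset (Finset (Fin n))).filter
        (fun J => ∃ S ∈ D, ∀ i ∈ J, P i ∈ S)).sup Finset.card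

theorem pr_mono {Ω : Type*} [Fintype Ω] {E F : Ω → Prop} (h : ∀ ω, E ω → F ω) :
    pr E ≤ pr F := by
  classical
  unfold pr
  gcongr with ω hω
  exact h ω

theorem pr_not {Ω : Type*} [Fintype Ω] [Nonempty Ω] (E : Ω → Prop) :
    pr (fun ω => ¬ E ω) = 1 - pr E := by
  classical
  unfold pr
  have h := Finset.card_filter_add_card_filter_not (s := (Finset.univ : Finset Ω)) E
  have h' : ((Finset.univ.filter E).card : ℝ) + (Finset.univ.filter fun ω => ¬ E ω).card =
      Fintype.card Ω := by
    rw [← Finset.card_univ, ← h]; push_cast; congr!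
  have hpos : (Fintype.card Ω : ℝ) ≠ 0 := by exact_mod_cast Fintype.card_ne_zero
  rw [eq_sub_iff_add_eq, ← add_div, div_eq_one_iff_eq hpos, ← h', add_comm]
  congr!

/-- Union bound. -/
theorem pr_exists_le {Ω ι : Type*} [Fintype Ω] (s : Finset ι) (E : ι → Ω → Prop) :
    pr (fun ω => ∃ i ∈ s, E i ω) ≤ ∑ i ∈ s, pr (E i) := by
  classical
  unfold pr
  rw [← Finset.sum_div]
  gcongr
  norm_cast
  refine le_trans (Finset.card_le_card ?_) Finset.card_biUnion_le
  intro ω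
  simp

/-- A Chernoff bound for i.i.d. uniform samples of a centred function with values in `[-1, 1]`. -/
theorem pr_sum_ge_le {ι : Type*} [Fintype ι] [Nonempty ι] (y : ι → ℝ) (hy : ∀ i, |y i| ≤ 1)
    (hsum : ∑ i, y i = 0) (ℓ : ℕ) (a : ℝ) (ha0 : 0 ≤ a) (ha1 : a ≤ 1) :
    pr (fun σ : Fin ℓ → ι => a * ℓ ≤ ∑ j, y (σ j)) ≤ Real.exp (-(a ^ 2 * ℓ / 4)) := by
  classical
  set t : ℝ := a / 2 with ht
  have ht0 : 0 ≤ t := by positivity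
  have hcard : (0 : ℝ) < Fintype.card ι := by exact_mod_cast Fintype.card_pos
  have hone : ∑ i, Real.exp (t * y i) ≤ Fintype.card ι * Real.exp (t ^ 2) := by
    have hpt : ∀ i, Real.exp (t * y i) ≤ 1 + t * y i + t ^ 2 := by
      intro i
      have hle : |t * y i| ≤ t := by
        rw [abs_mul, abs_of_nonneg ht0]
        exact mul_le_of_le_one_right ht0 (hy i)
      have hexp := (abs_le.1 (Real.abs_exp_sub_one_sub_id_le (x := t * y i) (by linarith))).2
      have hsq : (t * y i) ^ 2 ≤ t ^ 2 := sq_le_sq' (abs_le.1 hle).1 (abs_le.1 hle).2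
      linarith
    calc ∑ i, Real.exp (t * y i) ≤ ∑ i, (1 + t * y i + t ^ 2) :=
          Finset.sum_le_sum fun i _ => hpt i
      _ = Fintype.card ι * (t ^ 2 + 1) := by
          simp only [Finset.sum_add_distrib, ← Finset.mul_sum, hsum, Finset.sum_const,
            Finset.card_univ, nsmul_eq_mul]
          ring
      _ ≤ _ := by gcongr; exact Real.add_one_le_exp _
  have hall : ∑ σ : Fin ℓ → ι, Real.exp (t * ∑ j, y (σ j)) ≤
      (Fintype.card ι * Real.exp (t ^ 2)) ^ ℓ := by
    calc ∑ σ : Fin ℓ → ι, Real.exp (t * ∑ j, y (σ j))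
        = ∑ σ : Fin ℓ → ι, ∏ j, Real.exp (t * y (σ j)) := by
          simp only [Finset.mul_sum, Real.exp_sum]
      _ = (∑ i, Real.exp (t * y i)) ^ ℓ := by
          rw [Fintype.sum_pow]
      _ ≤ _ := by gcongr
  have hmarkov : ((Finset.univ.filter fun σ : Fin ℓ → ι => a * ℓ ≤ ∑ j, y (σ j)).card : ℝ) *
      Real.exp (t * (a * ℓ)) ≤ ∑ σ : Fin ℓ → ι, Real.exp (t * ∑ j, y (σ j)) := by
    rw [← nsmul_eq_mul]
    refine (Finset.card_nsmul_le_sum _ (fun σ : Fin ℓ → ι => Real.exp (t * ∑ j, y (σ j))) _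
      fun σ hσ => ?_).trans
      (Finset.sum_le_sum_of_subset_of_nonneg (Finset.filter_subset _ _)
        fun σ _ _ => (Real.exp_pos _).le)
    have := (Finset.mem_filter.1 hσ).2
    gcongr
  have hmain := hmarkov.trans hall
  rw [mul_pow, ← Real.exp_nat_mul] at hmain
  unfold pr
  rw [Fintype.card_fun, Fintype.card_fin, Nat.cast_pow, div_le_iff₀ (by positivity)]
  have hsplit : Real.exp (-(a ^ 2 * ℓ / 4)) =
      Real.exp (ℓ * t ^ 2) / Real.exp (t * (a * ℓ)) := by
    rw [← Real.exp_sub, ht]; congr 1; ring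
  rw [hsplit, div_mul_eq_mul_div, le_div_iff₀ (Real.exp_pos _), mul_comm (Real.exp (ℓ * t ^ 2))]
  convert hmain

/-- Number of positions of a profile whose preference lies outside `S`. -/
noncomputable def numOutside {A : Type*} {n : ℕ} (S : Finset (Pref A)) (P : Fin n → Pref A) : ℕ :=
  haveI := Classical.decPred (fun i => P i ∉ S)
  (Finset.univ.filter (fun i => P i ∉ S)).card

theorem numOutside_eq_sum {A : Type*} {n : ℕ} (S : Finset (Pref A)) (P : Fin n → Pref A)
    [DecidablePred (· ∈ S)] :
    (numOutside S P : ℝ) = ∑ i, if P i ∈ S then 0 else 1 := by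
  unfold numOutside
  rw [Finset.card_filter]
  push_cast
  exact Finset.sum_congr rfl fun i _ => by split_ifs <;> simp_all

theorem prefDist_le_numOutside {A : Type*} {n : ℕ} {D : Finset (Finset (Pref A))}
    {S : Finset (Pref A)} (hS : S ∈ D) (P : Fin n → Pref A) :
    prefDist D P ≤ numOutside S P := by
  classical
  unfold prefDist numOutside
  have hle : (Finset.univ.filter fun i => P i ∈ S).card ≤
      ((Finset.univ : Finset (Finset (Fin n))).filter
        (fun J => ∃ S ∈ D, ∀ i ∈ J, P i ∈ S)).sup Finset.card :=
    Finset.le_sup (f := Finset.card)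
      (Finset.mem_filter.2 ⟨Finset.mem_univ _, S, hS, by simp⟩)
  have hadd := Finset.card_filter_add_card_filter_not (s := (Finset.univ : Finset (Fin n)))
    (fun i => P i ∈ S)
  rw [Finset.card_univ, Fintype.card_fin] at hadd
  have hgoal : n - ((Finset.univ : Finset (Finset (Fin n))).filter
        (fun J => ∃ S ∈ D, ∀ i ∈ J, P i ∈ S)).sup Finset.card ≤
      (Finset.univ.filter fun i => P i ∉ S).card := by omega
  convert hgoal

theorem exists_numOutside_le_prefDist {A : Type*} {n : ℕ} {D : Finset (Finset (Pref A))}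
    (hD : D.Nonempty) (P : Fin n → Pref A) :
    ∃ S ∈ D, numOutside S P ≤ prefDist D P := by
  classical
  obtain ⟨S₀, hS₀⟩ := hD
  obtain ⟨J, hJ, hsup⟩ := Finset.exists_mem_eq_sup
    ((Finset.univ : Finset (Finset (Fin n))).filter (fun J => ∃ S ∈ D, ∀ i ∈ J, P i ∈ S))
    ⟨∅, by simpa using ⟨S₀, hS₀⟩⟩ Finset.card
  obtain ⟨S, hS, hJS⟩ := (Finset.mem_filter.1 hJ).2
  refine ⟨S, hS, ?_⟩
  have hsub : (Finset.univ.filter fun i => P i ∉ S).card ≤ Jᶜ.card :=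
    Finset.card_le_card fun i hi => by
      have := (Finset.mem_filter.1 hi).2
      exact Finset.mem_compl.2 fun hiJ => this (hJS i hiJ)
  rw [Finset.card_compl, Fintype.card_fin, ← hsup] at hsub
  unfold prefDist numOutside
  convert hsub

theorem card_pref_le (A : Type*) [Fintype A] [DecidableEq A] :
    Fintype.card (Pref A) ≤ Fintype.card A ^ Fintype.card A := by
  have hlt : ∀ (r : Pref A) (a : A), (Finset.univ.filter fun b => r.1 b a).card <
      Fintype.card A := fun r a =>
    Finset.card_lt_univ_of_notMem (x := a) (by simpa using r.2.1 a)
  have key : ∀ (r : Pref A) (a b : A), r.1 a b →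
      (Finset.univ.filter fun c => r.1 c a).card < (Finset.univ.filter fun c => r.1 c b).card := by
    intro r a b hab
    refine Finset.card_lt_card (Finset.ssubset_iff_subset_ne.2 ⟨fun c hc => ?_, fun h => ?_⟩)
    · simp only [Finset.mem_filter, Finset.mem_univ, true_and] at hc ⊢
      exact r.2.2.1 c a b hc hab
    · have : a ∈ Finset.univ.filter fun c => r.1 c b := by simpa using hab
      rw [← h] at this
      exact r.2.1 a (Finset.mem_filter.1 this).2
  have key' : ∀ (r : Pref A) (a b : A), r.1 a b ↔
      (Finset.univ.filter fun c => r.1 c a).card < (Finset.univ.filter fun c => r.1 c b).card := by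
    refine fun r a b => ⟨key r a b, fun h => ?_⟩
    have hne : a ≠ b := by rintro rfl; exact lt_irrefl _ h
    exact (r.2.2.2 a b hne).resolve_right fun hba => (key r b a hba).not_gt h
  let rank : Pref A → A → Fin (Fintype.card A) := fun r a => ⟨_, hlt r a⟩
  have hinj : Function.Injective rank := by
    intro r s h
    refine Subtype.ext (funext fun a => funext fun b => Bool.eq_iff_iff.2 ?_)
    have hrank := fun a => congrArg Fin.val (congrFun h a)
    simp only [rank] at hrank
    rw [key' r, key' s, hrank a, hrank b]
  simpa using Fintype.card_le_of_injective rank hinj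

theorem card_family_le {α : Type*} [Fintype α] (D : Finset (Finset α)) (K : ℕ)
    (hK : ∀ S ∈ D, S.card ≤ K) : D.card ≤ (Fintype.card α + 1) ^ K := by
  classical
  let Φ : (Fin K → Option α) → Finset α := fun g => Finset.univ.filter fun x => ∃ i, g i = some x
  have hsub : D ⊆ Finset.univ.image Φ := by
    intro S hS
    refine Finset.mem_image.2
      ⟨fun i => if h : i.1 < S.card then some (S.equivFin.symm ⟨i, h⟩).1 else none,
        Finset.mem_univ _, ?_⟩
    ext x
    simp only [Φ, Finset.mem_filter, Finset.mem_univ, true_and]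
    constructor
    · rintro ⟨i, hi⟩
      split_ifs at hi with h
      rw [← Option.some.inj hi]
      exact (S.equivFin.symm ⟨i, h⟩).2
    · intro hx
      refine ⟨⟨S.equivFin ⟨x, hx⟩, (S.equivFin ⟨x, hx⟩).2.trans_le (hK S hS)⟩, ?_⟩
      simp
  calc D.card ≤ (Finset.univ.image Φ).card := Finset.card_le_card hsub
    _ ≤ Fintype.card (Fin K → Option α) := Finset.card_image_le
    _ = _ := by simp

theorem card_family_pref_le {A : Type*} [Fintype A] [DecidableEq A] (hA : 2 ≤ Fintype.card A)
    (D : Finset (Finset (Pref A))) (K : ℕ) (hK : ∀ S ∈ D, S.card ≤ K) :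
    (D.card : ℝ) ≤ Real.exp (2 * (K * Fintype.card A * Real.log (Fintype.card A))) := by
  set m := Fintype.card A with hm
  have hpow : 2 ≤ m ^ m := hA.trans (Nat.le_self_pow (by omega) m)
  have hN : Fintype.card (Pref A) + 1 ≤ m ^ (2 * m) := by
    have h1 := card_pref_le A
    rw [← hm] at h1
    rw [two_mul, pow_add]
    nlinarith
  have hD : (D.card : ℝ) ≤ (m : ℝ) ^ (2 * m * K) := by
    exact_mod_cast (card_family_le D K hK).trans
      ((Nat.pow_le_pow_left hN K).trans_eq (pow_mul _ _ _).symm)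
  refine hD.trans_eq ?_
  have hm0 : (0 : ℝ) < m := by exact_mod_cast (by omega : 0 < m)
  rw [← Real.exp_log (pow_pos hm0 _), Real.log_pow]
  push_cast
  ring_nf

/-- Two-sided concentration of the number of sampled preferences outside `S`. -/
theorem pr_numOutside_ge_le {A : Type*} {n : ℕ} (hn : 1 ≤ n) (S : Finset (Pref A))
    (P : Fin n → Pref A) (ℓ : ℕ) (a : ℝ) (ha0 : 0 ≤ a) (ha1 : a ≤ 1) :
    pr (fun σ : Fin ℓ → Fin n =>
        (numOutside S P / n + a) * ℓ ≤ numOutside S (fun j => P (σ j))) ≤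
      Real.exp (-(a ^ 2 * ℓ / 4)) ∧
    pr (fun σ : Fin ℓ → Fin n =>
        (numOutside S (fun j => P (σ j)) : ℝ) ≤ (numOutside S P / n - a) * ℓ) ≤
      Real.exp (-(a ^ 2 * ℓ / 4)) := by
  classical
  have : Nonempty (Fin n) := ⟨⟨0, hn⟩⟩
  have hn0 : (0 : ℝ) < n := by exact_mod_cast hn
  set x : Fin n → ℝ := fun i => if P i ∈ S then 0 else 1 with hx
  have hx0 : ∀ i, 0 ≤ x i ∧ x i ≤ 1 := fun i => by
    simp only [hx]; split_ifs <;> norm_num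
  set μ : ℝ := numOutside S P / n with hμ
  have hsumx : ∑ i, x i = n * μ := by
    rw [hμ, mul_div_cancel₀ _ hn0.ne', numOutside_eq_sum]
  have hμ0 : 0 ≤ μ := by positivity
  have hμ1 : μ ≤ 1 := by
    have : ∑ i, x i ≤ ∑ _i : Fin n, (1 : ℝ) := Finset.sum_le_sum fun i _ => (hx0 i).2
    rw [hsumx] at this
    simp only [Finset.sum_const, Finset.card_univ, Fintype.card_fin, nsmul_eq_mul] at this
    exact le_of_mul_le_mul_left this hn0
  have hsample : ∀ σ : Fin ℓ → Fin n,
      (numOutside S (fun j => P (σ j)) : ℝ) = ∑ j, x (σ j) := fun σ => by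
    rw [numOutside_eq_sum]
  constructor
  · refine le_trans (pr_mono fun σ hσ => ?_) (pr_sum_ge_le (fun i => x i - μ) (fun i => ?_)
      ?_ ℓ a ha0 ha1)
    · rw [hsample] at hσ
      simp only [Finset.sum_sub_distrib, Finset.sum_const, Finset.card_univ, Fintype.card_fin,
        nsmul_eq_mul]
      linarith
    · rw [abs_le]; constructor <;> linarith [hx0 i]
    · simp [hsumx]
  · refine le_trans (pr_mono fun σ hσ => ?_) (pr_sum_ge_le (fun i => μ - x i) (fun i => ?_)
      ?_ ℓ a ha0 ha1)
    · rw [hsample] at hσ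
      simp only [Finset.sum_sub_distrib, Finset.sum_const, Finset.card_univ, Fintype.card_fin,
        nsmul_eq_mul]
      linarith
    · rw [abs_le]; constructor <;> linarith [hx0 i]
    · simp [hsumx]


/-- tester distinguishing profiles at preference-distance at most `εn`
from profiles at distance at least `ε'n` from an arbitrary domain. -/
theorem stmt_8 {A : Type*} [Fintype A] [DecidableEq A] (m : ℕ) (hm : Fintype.card A = m)
    (hm2 : 2 ≤ m) (D : Finset (Finset (Pref A))) (K : ℕ) (hD : D.Nonempty)
    (hK : ∀ S ∈ D, S.card ≤ K)
    (ε ε' δ : ℝ) (hε0 : 0 ≤ ε) (hεε' : ε < ε') (hε'1 : ε' < 1)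
    (hδ0 : 0 < δ) (hδ1 : δ < 1/2)
    (ℓ : ℕ) (hℓ : ℓ = ⌈(64 / (ε' - ε)^2) * (K * m * Real.log m + Real.log (1/δ))⌉₊)
    (f : (Fin ℓ → Pref A) → Bool)
    (hf : ∀ S : Fin ℓ → Pref A, f S = true ↔ (prefDist D S : ℝ) ≤ (ε + ε') * ℓ / 2) :
    ∀ n : ℕ, 1 ≤ n → ∀ P : Fin n → Pref A,
      ((prefDist D P : ℝ) ≤ ε * n →
        pr (fun σ : Fin ℓ → Fin n => f (fun j => P (σ j)) = true) ≥ 1 - δ) ∧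
      (ε' * n ≤ (prefDist D P : ℝ) →
        pr (fun σ : Fin ℓ → Fin n => f (fun j => P (σ j)) = false) ≥ 1 - δ) := by
  classical
  intro n hn P
  have : Nonempty (Fin n) := ⟨⟨0, hn⟩⟩
  subst hm
  have hn0 : (0 : ℝ) < n := by exact_mod_cast hn
  set B : ℝ := K * Fintype.card A * Real.log (Fintype.card A) with hB
  have hB0 : 0 ≤ B := mul_nonneg (by positivity) (Real.log_natCast_nonneg _)
  set a : ℝ := (ε' - ε) / 2 with ha
  have ha0 : 0 < a := by rw [ha]; linarith
  have ha1 : a ≤ 1 := by rw [ha]; linarith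
  have hlarge : 4 * (B + Real.log (1 / δ)) ≤ a ^ 2 * ℓ / 4 := by
    have hceil : 64 / (ε' - ε) ^ 2 * (B + Real.log (1 / δ)) ≤ ℓ := hℓ ▸ Nat.le_ceil _
    have hsq : 0 < (ε' - ε) ^ 2 := by have := sub_pos.2 hεε'; positivity
    rw [div_mul_eq_mul_div, div_le_iff₀ hsq] at hceil
    rw [ha]
    linarith
  have hlogδ : 0 < Real.log (1 / δ) := Real.log_pos (by rw [lt_div_iff₀ hδ0]; linarith)
  have htail : Real.exp (2 * B) * Real.exp (-(a ^ 2 * ℓ / 4)) ≤ δ := by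
    rw [← Real.exp_add, ← Real.exp_log hδ0, Real.exp_le_exp]
    rw [one_div, Real.log_inv] at hlarge hlogδ
    linarith
  have htail' : Real.exp (-(a ^ 2 * ℓ / 4)) ≤ δ :=
    (le_mul_of_one_le_left (Real.exp_pos _).le (Real.one_le_exp (by linarith))).trans htail
  constructor
  · intro hdist
    obtain ⟨S, hS, hSP⟩ := exists_numOutside_le_prefDist hD P
    have hμ : (numOutside S P : ℝ) / n ≤ ε := by
      rw [div_le_iff₀ hn0]
      exact le_trans (by exact_mod_cast hSP) hdist
    have hbad : pr (fun σ : Fin ℓ → Fin n => ¬ f (fun j => P (σ j)) = true) ≤ δ := by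
      refine le_trans (pr_mono fun σ hσ => ?_)
        ((pr_numOutside_ge_le hn S P ℓ a ha0.le ha1).1.trans htail')
      rw [hf, not_le] at hσ
      have hle : (prefDist D (fun j => P (σ j)) : ℝ) ≤ numOutside S (fun j => P (σ j)) := by
        exact_mod_cast prefDist_le_numOutside hS _
      refine le_trans ?_ (hσ.le.trans hle)
      calc (numOutside S P / n + a) * ℓ ≤ (ε + a) * ℓ := by gcongr
        _ = (ε + ε') * ℓ / 2 := by rw [ha]; ring
    rw [pr_not] at hbad
    linarith
  · intro hdist
    have hbad : pr (fun σ : Fin ℓ → Fin n => ¬ f (fun j => P (σ j)) = false) ≤ δ := by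
      calc pr (fun σ : Fin ℓ → Fin n => ¬ f (fun j => P (σ j)) = false)
          ≤ pr (fun σ : Fin ℓ → Fin n => ∃ S ∈ D,
              (numOutside S (fun j => P (σ j)) : ℝ) ≤ (numOutside S P / n - a) * ℓ) := by
            refine pr_mono fun σ hσ => ?_
            rw [Bool.not_eq_false, hf] at hσ
            obtain ⟨S, hS, hSσ⟩ := exists_numOutside_le_prefDist hD (fun j => P (σ j))
            have hμ : ε' ≤ (numOutside S P : ℝ) / n := by
              rw [le_div_iff₀ hn0]
              exact hdist.trans (by exact_mod_cast prefDist_le_numOutside hS P)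
            refine ⟨S, hS, le_trans (by exact_mod_cast hSσ) (hσ.trans ?_)⟩
            calc (ε + ε') * ℓ / 2 = (ε' - a) * ℓ := by rw [ha]; ring
              _ ≤ (numOutside S P / n - a) * ℓ := by gcongr
        _ ≤ ∑ S ∈ D, pr (fun σ : Fin ℓ → Fin n =>
              (numOutside S (fun j => P (σ j)) : ℝ) ≤ (numOutside S P / n - a) * ℓ) :=
            pr_exists_le D _
        _ ≤ ∑ _S ∈ D, Real.exp (-(a ^ 2 * ℓ / 4)) :=
            Finset.sum_le_sum fun S _ => (pr_numOutside_ge_le hn S P ℓ a ha0.le ha1).2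
        _ = D.card * Real.exp (-(a ^ 2 * ℓ / 4)) := by rw [Finset.sum_const, nsmul_eq_mul]
        _ ≤ Real.exp (2 * B) * Real.exp (-(a ^ 2 * ℓ / 4)) := by
            gcongr
            exact card_family_pref_le hm2 D K hK
        _ ≤ δ := htail
    rw [pr_not] at hbad
    linarith
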